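/- There exists a constant C ∈ ℕ (independent of r, P, T, m and the strip) such that the following holds: let k = |P| and let m ≥ 1 be a natural number; if there exists an optimal solution, then there exists an optimal solution S such that for every axis-aligned closed rectangle of width r and height 2mr (a vertical strip of a cell of size 2mr × 2mr), the number of sensors of S lying in that rectangle is at most C·(m + k). -/

import Mathlib

/-- The set of points covered by a finite set `S` of sensors with sensing
radius `r` includes every target: for each `t ∈ T` there is `s ∈ S` with
`dist s t ≤ r`. -/
def Covers (r : ℝ) (T : Set (EuclideanSpace ℝ (Fin 2)))
    (S : Finset (EuclideanSpace ℝ (Fin 2))) : Prop :=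
  ∀ t ∈ T, ∃ s ∈ S, dist s t ≤ r

/-- The total moving cost of a sensor set `S`: each sensor moves from its
nearest station in `P`. -/
noncomputable def cost (P S : Finset (EuclideanSpace ℝ (Fin 2))) : ℝ :=
  ∑ s ∈ S, Metric.infDist s (P : Set (EuclideanSpace ℝ (Fin 2)))

/-- `S` is an optimal solution: it covers `T` and has minimum cost among all
finite sensor sets covering `T`. -/
def Optimal (r : ℝ) (P : Finset (EuclideanSpace ℝ (Fin 2)))
    (T : Set (EuclideanSpace ℝ (Fin 2)))
    (S : Finset (EuclideanSpace ℝ (Fin 2))) : Prop :=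
  Covers r T S ∧
    ∀ S' : Finset (EuclideanSpace ℝ (Fin 2)), Covers r T S' → cost P S ≤ cost P S'

abbrev Plane : Type := EuclideanSpace ℝ (Fin 2)

lemma dist_le_iff_coord {x y : Plane} {r : ℝ} (hr : 0 ≤ r) :
    dist x y ≤ r ↔ (x 0 - y 0) ^ 2 + (x 1 - y 1) ^ 2 ≤ r ^ 2 := by
  rw [EuclideanSpace.dist_eq, Fin.sum_univ_two, Real.sqrt_le_left hr, Real.dist_eq, Real.dist_eq,
    sq_abs, sq_abs]

lemma dist_sq_eq_coord (x y : Plane) :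
    dist x y ^ 2 = (x 0 - y 0) ^ 2 + (x 1 - y 1) ^ 2 := by
  rw [EuclideanSpace.dist_eq, Fin.sum_univ_two, Real.sq_sqrt (by positivity), Real.dist_eq,
    Real.dist_eq, sq_abs, sq_abs]

lemma cost_insert_le (P B : Finset Plane) (a : Plane) :
    cost P (insert a B) ≤ Metric.infDist a (P : Set Plane) + cost P B := by
  by_cases h : a ∈ B
  · rw [Finset.insert_eq_of_mem h]
    exact le_add_of_nonneg_left Metric.infDist_nonneg
  · exact (Finset.sum_insert h).le

lemma cost_union_le (P A B : Finset Plane) : cost P (A ∪ B) ≤ cost P A + cost P B := by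
  have h := Finset.sum_union_inter (s₁ := A) (s₂ := B)
    (f := fun s => Metric.infDist s (P : Set Plane))
  have h' : 0 ≤ cost P (A ∩ B) := Finset.sum_nonneg fun _ _ => Metric.infDist_nonneg
  unfold cost at *
  linarith

/-- In an optimal solution, exchanging the sensors `A` for sensors `B` that take over their
targets cannot lower the cost. -/
lemma Optimal.cost_le_of_exchange {r : ℝ} {P S A B : Finset Plane} {T : Set Plane}
    (hS : Optimal r P T S) (hA : A ⊆ S)
    (h : ∀ t ∈ T, (∃ s ∈ A, dist s t ≤ r) → (∀ s ∈ S, s ∉ A → r < dist s t) →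
      ∃ b ∈ B, dist b t ≤ r) :
    cost P A ≤ cost P B := by
  have hcov : Covers r T (S \ A ∪ B) := by
    intro t ht
    by_cases h1 : ∃ s ∈ S, s ∉ A ∧ dist s t ≤ r
    · obtain ⟨s, hs, hsA, hd⟩ := h1
      exact ⟨s, by simp [hs, hsA], hd⟩
    · push Not at h1
      obtain ⟨s, hs, hd⟩ := hS.1 t ht
      have hsA : s ∈ A := by
        by_contra hn
        exact absurd hd (not_le.2 (h1 s hs hn))
      obtain ⟨b, hb, hbd⟩ := h t ht ⟨s, hsA, hd⟩ h1
      exact ⟨b, by simp [hb], hbd⟩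
  have h1 := hS.2 _ hcov
  have h2 := cost_union_le P (S \ A) B
  have h3 : cost P (S \ A) + cost P A = cost P S := Finset.sum_sdiff hA
  linarith

/-- The point `q` together with its four translates by `2 * d` along the axes. -/
noncomputable def cross (q : Plane) (d : ℝ) : Finset Plane :=
  {q, q + !₂[2 * d, 0], q + !₂[-(2 * d), 0], q + !₂[0, 2 * d], q + !₂[0, -(2 * d)]}

lemma sq_add_sq_le_of_axis {r d u v : ℝ} (hd : 0 ≤ d) (hdr : 3 * d ≤ r) (hu : 0 ≤ u)
    (hvu : v ^ 2 ≤ u ^ 2) (hle : u ^ 2 + v ^ 2 ≤ (r + d) ^ 2) (hlt : r ^ 2 < u ^ 2 + v ^ 2) :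
    (2 * d - u) ^ 2 + v ^ 2 ≤ r ^ 2 := by
  obtain ⟨ρ, hρ0, hρ⟩ : ∃ ρ : ℝ, 0 ≤ ρ ∧ ρ ^ 2 = u ^ 2 + v ^ 2 :=
    ⟨√(u ^ 2 + v ^ 2), Real.sqrt_nonneg _, Real.sq_sqrt (by positivity)⟩
  have hr : 0 ≤ r := by linarith
  have h1 : r ≤ ρ := by apply le_of_sq_le_sq _ hρ0; linarith
  have h2 : ρ ≤ r + d := by apply le_of_sq_le_sq _ (by linarith); linarith
  have h3 : 7 / 10 * ρ ≤ u := by apply le_of_sq_le_sq _ hu; nlinarith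
  nlinarith [mul_nonneg (sub_nonneg.2 h1) (sub_nonneg.2 h2), mul_le_mul_of_nonneg_left h3 hd,
    mul_le_mul_of_nonneg_left h2 (by linarith : 0 ≤ 2 * r - 9 / 5 * d),
    mul_le_mul_of_nonneg_left hdr hd]

lemma exists_mem_cross {r d : ℝ} {q t : Plane} (hd : 0 ≤ d) (hdr : 3 * d ≤ r)
    (ht : dist q t ≤ r + d) : ∃ b ∈ cross q d, dist b t ≤ r := by
  have hr : 0 ≤ r := by linarith
  rw [dist_le_iff_coord (by linarith)] at ht
  by_cases h0 : (q 0 - t 0) ^ 2 + (q 1 - t 1) ^ 2 ≤ r ^ 2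
  · exact ⟨q, by simp [cross], (dist_le_iff_coord hr).2 h0⟩
  push Not at h0
  have ht' : (q 1 - t 1) ^ 2 + (q 0 - t 0) ^ 2 ≤ (r + d) ^ 2 := by linarith
  have h0' : r ^ 2 < (q 1 - t 1) ^ 2 + (q 0 - t 0) ^ 2 := by linarith
  rcases le_total ((q 1 - t 1) ^ 2) ((q 0 - t 0) ^ 2) with h1 | h1
  · rcases le_total 0 (q 0 - t 0) with h2 | h2
    · refine ⟨q + !₂[-(2 * d), 0], by simp [cross], (dist_le_iff_coord hr).2 ?_⟩
      have := sq_add_sq_le_of_axis hd hdr h2 h1 ht h0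
      simp
      linarith
    · refine ⟨q + !₂[2 * d, 0], by simp [cross], (dist_le_iff_coord hr).2 ?_⟩
      have := sq_add_sq_le_of_axis (u := -(q 0 - t 0)) (v := q 1 - t 1) hd hdr (by linarith)
        (by rwa [neg_sq]) (by rwa [neg_sq]) (by rwa [neg_sq])
      simp
      linarith
  · rcases le_total 0 (q 1 - t 1) with h2 | h2
    · refine ⟨q + !₂[0, -(2 * d)], by simp [cross], (dist_le_iff_coord hr).2 ?_⟩
      have := sq_add_sq_le_of_axis hd hdr h2 h1 ht' h0'
      simp
      linarith
    · refine ⟨q + !₂[0, 2 * d], by simp [cross], (dist_le_iff_coord hr).2 ?_⟩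
      have := sq_add_sq_le_of_axis (u := -(q 1 - t 1)) (v := q 0 - t 0) hd hdr (by linarith)
        (by rwa [neg_sq]) (by rwa [neg_sq]) (by rwa [neg_sq])
      simp
      linarith

lemma cost_cross_le (P : Finset Plane) (q : Plane) {d : ℝ} (hd : 0 ≤ d) :
    cost P (cross q d) ≤ 5 * Metric.infDist q (P : Set Plane) + 8 * d := by
  have key : ∀ w : Plane, ‖w‖ ≤ 2 * d →
      Metric.infDist (q + w) (P : Set Plane) ≤ Metric.infDist q (P : Set Plane) + 2 * d := by
    intro w hw
    have := Metric.infDist_le_infDist_add_dist (s := (P : Set Plane)) (x := q + w) (y := q)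
    rw [dist_self_add_left] at this
    linarith
  have hn : ∀ a b : ℝ, a ^ 2 + b ^ 2 ≤ (2 * d) ^ 2 → ‖(!₂[a, b] : Plane)‖ ≤ 2 * d := by
    intro a b h
    rw [← dist_zero_right, dist_le_iff_coord (by linarith)]
    simpa using h
  have h1 := key !₂[2 * d, 0] (hn _ _ (by simp))
  have h2 := key !₂[-(2 * d), 0] (hn _ _ (by simp))
  have h3 := key !₂[0, 2 * d] (hn _ _ (by simp))
  have h4 := key !₂[0, -(2 * d)] (hn _ _ (by simp))
  have e0 := cost_insert_le P {q + !₂[2 * d, 0], q + !₂[-(2 * d), 0], q + !₂[0, 2 * d],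
    q + !₂[0, -(2 * d)]} q
  have e1 := cost_insert_le P {q + !₂[-(2 * d), 0], q + !₂[0, 2 * d], q + !₂[0, -(2 * d)]}
    (q + !₂[2 * d, 0])
  have e2 := cost_insert_le P {q + !₂[0, 2 * d], q + !₂[0, -(2 * d)]} (q + !₂[-(2 * d), 0])
  have e3 := cost_insert_le P {q + !₂[0, -(2 * d)]} (q + !₂[0, 2 * d])
  have e4 : cost P {q + !₂[0, -(2 * d)]} = Metric.infDist (q + !₂[0, -(2 * d)]) (P : Set Plane) :=
    Finset.sum_singleton _ _
  unfold cross
  linarith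

/-- Sensors of an optimal solution near a point `q` cost at most as much as a cross around `q`. -/
lemma Optimal.cost_le_cross {r d : ℝ} {P S A : Finset Plane} {T : Set Plane} {q : Plane}
    (hS : Optimal r P T S) (hA : A ⊆ S) (hd : 0 ≤ d) (hdr : 3 * d ≤ r)
    (hAd : ∀ s ∈ A, dist s q ≤ d) :
    cost P A ≤ 5 * Metric.infDist q (P : Set Plane) + 8 * d := by
  refine (hS.cost_le_of_exchange hA ?_).trans (cost_cross_le P q hd)
  rintro t - ⟨s, hs, hst⟩ -
  apply exists_mem_cross hd hdr
  have := dist_triangle_left q t s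
  have := hAd s hs
  linarith

lemma card_mul_le_cost {P A : Finset Plane} {c : ℝ}
    (h : ∀ s ∈ A, c ≤ Metric.infDist s (P : Set Plane)) : A.card * c ≤ cost P A := by
  rw [← nsmul_eq_mul]
  exact Finset.card_nsmul_le_sum _ _ _ h

lemma Optimal.card_far_le {r : ℝ} {P S A : Finset Plane} {T : Set Plane} (hr : 0 < r)
    (hS : Optimal r P T S) (hA : A ⊆ S)
    (hdiam : ∀ s ∈ A, ∀ s' ∈ A, dist s s' ≤ r / 3)
    (hfar : ∀ s ∈ A, r / 3 < Metric.infDist s (P : Set Plane)) : A.card ≤ 13 := by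
  rcases A.eq_empty_or_nonempty with rfl | hne
  · simp
  obtain ⟨q, hq, hmin⟩ := A.exists_min_image (fun s => Metric.infDist s (P : Set Plane)) hne
  have h1 := hS.cost_le_cross hA (by positivity) (by linarith) (fun s hs => hdiam s hs q hq)
  have h2 := card_mul_le_cost hmin
  have h3 := hfar q hq
  have h4 : (A.card : ℝ) * Metric.infDist q (P : Set Plane)
      ≤ 13 * Metric.infDist q (P : Set Plane) := by linarith
  exact_mod_cast le_of_mul_le_mul_right h4 (by linarith)

lemma norm_lune_center_le {a A κ x y X Y : ℝ} (ha : 0 < a) (hA : 0 < A) (hκ : a = κ * A)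
    (hxy : x ^ 2 + y ^ 2 = a ^ 2) (hXY : X ^ 2 + Y ^ 2 = A ^ 2)
    (hdot : 7 / 10 * (a * A) ≤ x * X + y * Y) :
    (107 / 100 * x - 7 / 10 * κ * X) ^ 2 + (107 / 100 * y - 7 / 10 * κ * Y) ^ 2
      ≤ (78 / 100 * a) ^ 2 := by
  have hκ0 : 0 < κ := pos_of_mul_pos_left (hκ ▸ ha) hA.le
  have h1 : κ * (7 / 10 * (a * A)) ≤ κ * (x * X + y * Y) := mul_le_mul_of_nonneg_left hdot hκ0.le
  have h2 : κ * (a * A) = a ^ 2 := by rw [hκ]; ring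
  have h3 : κ ^ 2 * (X ^ 2 + Y ^ 2) = a ^ 2 := by rw [hXY, hκ]; ring
  nlinarith

/-- The point `(x, y)` is much closer to the origin than `(X, Y)`, in a similar direction. A point
of the disc around `(x, y)` outside the disc around `(X, Y)` is then either near the disc around
the origin or in the disc around a point which is closer to the origin than `(x, y)`. -/
lemma lune_subset {r a A κ x y X Y u v : ℝ} (hr : 0 < r) (ha : 0 < a) (hA : 0 < A)
    (hκ : a = κ * A) (hκ' : κ ≤ 1 / 250) (hAr : A ≤ r / 250)
    (hxy : x ^ 2 + y ^ 2 = a ^ 2) (hXY : X ^ 2 + Y ^ 2 = A ^ 2)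
    (hdot : 7 / 10 * (a * A) ≤ x * X + y * Y)
    (hs : (x - u) ^ 2 + (y - v) ^ 2 ≤ r ^ 2) (hS : r ^ 2 < (X - u) ^ 2 + (Y - v) ^ 2) :
    u ^ 2 + v ^ 2 ≤ (r + a / 40) ^ 2 ∨
      (107 / 100 * x - 7 / 10 * κ * X - u) ^ 2 + (107 / 100 * y - 7 / 10 * κ * Y - v) ^ 2
        ≤ r ^ 2 := by
  have hκ0 : 0 < κ := pos_of_mul_pos_left (hκ ▸ ha) hA.le
  have hcenter := norm_lune_center_le ha hA hκ hxy hXY hdot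
  obtain ⟨M, hM⟩ : ∃ M, M = x * u + y * v := ⟨_, rfl⟩
  obtain ⟨N, hN⟩ : ∃ N, N = X * u + Y * v := ⟨_, rfl⟩
  have h1 : u ^ 2 + v ^ 2 + a ^ 2 - 2 * M ≤ r ^ 2 := by rw [← hxy, hM]; linarith
  have h2 : r ^ 2 < u ^ 2 + v ^ 2 + A ^ 2 - 2 * N := by rw [← hXY, hN]; linarith
  rcases lt_or_ge M (a * r / 40) with h | h
  · left
    nlinarith
  · right
    have h3 : κ * (2 * N) ≤ κ * (2 * M + A ^ 2) := by
      apply mul_le_mul_of_nonneg_left _ hκ0.le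
      nlinarith
    have h4 : κ * A ^ 2 ≤ a * (r / 250) := by
      rw [show κ * A ^ 2 = a * A by rw [hκ]; ring]
      exact mul_le_mul_of_nonneg_left hAr ha.le
    have hM0 : 0 ≤ M := le_trans (by positivity) h
    have h5 : κ * M ≤ 1 / 250 * M := mul_le_mul_of_nonneg_right hκ' hM0
    have h6 : M ≤ 107 / 100 * M - 7 / 10 * (κ * N) := by linarith
    have h7 : (78 / 100 * a) ^ 2 ≤ a ^ 2 := by nlinarith
    have h8 : (107 / 100 * x - 7 / 10 * κ * X - u) ^ 2 + (107 / 100 * y - 7 / 10 * κ * Y - v) ^ 2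
        = (107 / 100 * x - 7 / 10 * κ * X) ^ 2 + (107 / 100 * y - 7 / 10 * κ * Y) ^ 2
          + (u ^ 2 + v ^ 2) - 2 * (107 / 100 * M - 7 / 10 * (κ * N)) := by
      rw [hM, hN]; ring
    linarith

lemma Optimal.not_similar_direction {r a A : ℝ} {P S : Finset Plane} {T : Set Plane}
    {p s s' : Plane} (hr : 0 < r) (hS : Optimal r P T S) (hp : p ∈ P) (hs : s ∈ S) (hs' : s' ∈ S)
    (ha : 0 < a) (haA : a ≤ A / 250) (hAr : A ≤ r / 250) (hsp : dist s p = a)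
    (hs'p : dist s' p = A) (hinf : Metric.infDist s (P : Set Plane) = a)
    (hdot : 7 / 10 * (a * A) ≤ (s 0 - p 0) * (s' 0 - p 0) + (s 1 - p 1) * (s' 1 - p 1)) :
    False := by
  have hA : 0 < A := by linarith
  have hne : s' ≠ s := by
    rintro rfl
    linarith
  have hκ : a = a / A * A := by field_simp
  have hκ' : a / A ≤ 1 / 250 := by
    rw [div_le_iff₀ hA]
    linarith
  have hxy := (dist_sq_eq_coord s p).symm
  have hXY := (dist_sq_eq_coord s' p).symm
  rw [hsp] at hxy
  rw [hs'p] at hXY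
  set q : Plane := p + !₂[107 / 100 * (s 0 - p 0) - 7 / 10 * (a / A) * (s' 0 - p 0),
    107 / 100 * (s 1 - p 1) - 7 / 10 * (a / A) * (s' 1 - p 1)] with hq
  have hq0 : q 0 = p 0 + (107 / 100 * (s 0 - p 0) - 7 / 10 * (a / A) * (s' 0 - p 0)) := by
    simp [hq]
  have hq1 : q 1 = p 1 + (107 / 100 * (s 1 - p 1) - 7 / 10 * (a / A) * (s' 1 - p 1)) := by
    simp [hq]
  have hqp : dist q p ≤ 78 / 100 * a := by
    rw [dist_le_iff_coord (by positivity), hq0, hq1, add_sub_cancel_left, add_sub_cancel_left]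
    exact norm_lune_center_le ha hA hκ hxy hXY hdot
  have hle : cost P {s} ≤ cost P (insert q (cross p (a / 40))) := by
    apply hS.cost_le_of_exchange (Finset.singleton_subset_iff.2 hs)
    rintro t - ⟨s₁, hs₁, hst⟩ hfar
    obtain rfl := Finset.mem_singleton.1 hs₁
    have hs't := hfar s' hs' (by simpa using hne)
    rw [dist_le_iff_coord hr.le] at hst
    rw [← not_le, dist_le_iff_coord hr.le, not_le] at hs't
    rcases lune_subset (u := t 0 - p 0) (v := t 1 - p 1) hr ha hA hκ hκ' hAr hxy hXY hdot
      (by simpa using hst) (by simpa using hs't) with h | h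
    · obtain ⟨b, hb, hbt⟩ := exists_mem_cross (r := r) (d := a / 40) (q := p) (t := t)
        (by positivity) (by linarith)
        (by rw [dist_comm, dist_le_iff_coord (by positivity)]; exact h)
      exact ⟨b, Finset.mem_insert_of_mem hb, hbt⟩
    · refine ⟨q, Finset.mem_insert_self _ _, (dist_le_iff_coord hr.le).2 ?_⟩
      rw [hq0, hq1]
      linarith
  have h1 := cost_insert_le P (cross p (a / 40)) q
  have h2 := cost_cross_le P p (d := a / 40) (by positivity)
  have h3 : Metric.infDist p (P : Set Plane) = 0 := Metric.infDist_zero_of_mem hp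
  have h4 := Metric.infDist_le_dist_of_mem (x := q) (s := (P : Set Plane)) hp
  have h5 : cost P {s} = a := by rw [← hinf]; exact Finset.sum_singleton _ _
  linarith

/-- The octant of the plane containing `(x, y)`. -/
noncomputable def octant (x y : ℝ) : Bool × Bool × Bool :=
  (decide (0 ≤ x), decide (0 ≤ y), decide (y ^ 2 ≤ x ^ 2))

lemma dot_ge_of_octant_eq {a A x y X Y : ℝ}
    (hxy : x ^ 2 + y ^ 2 = a ^ 2) (hXY : X ^ 2 + Y ^ 2 = A ^ 2)
    (h : octant x y = octant X Y) : 7 / 10 * (a * A) ≤ x * X + y * Y := by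
  simp only [octant, Prod.mk.injEq, decide_eq_decide] at h
  obtain ⟨hx, hy, hc⟩ := h
  have hxX : 0 ≤ x * X := by
    by_cases h0 : 0 ≤ x
    · exact mul_nonneg h0 (hx.1 h0)
    · exact mul_nonneg_of_nonpos_of_nonpos (not_le.1 h0).le (not_le.1 (mt hx.2 h0)).le
  have hyY : 0 ≤ y * Y := by
    by_cases h0 : 0 ≤ y
    · exact mul_nonneg h0 (hy.1 h0)
    · exact mul_nonneg_of_nonpos_of_nonpos (not_le.1 h0).le (not_le.1 (mt hy.2 h0)).le
  have hsq : 0 ≤ (x ^ 2 - y ^ 2) * (X ^ 2 - Y ^ 2) := by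
    by_cases h0 : y ^ 2 ≤ x ^ 2
    · exact mul_nonneg (sub_nonneg.2 h0) (sub_nonneg.2 (hc.1 h0))
    · exact mul_nonneg_of_nonpos_of_nonpos (sub_nonpos.2 (not_le.1 h0).le)
        (sub_nonpos.2 (not_le.1 (mt hc.2 h0)).le)
  apply le_of_sq_le_sq _ (by positivity)
  have h1 : (a * A) ^ 2 = (x ^ 2 + y ^ 2) * (X ^ 2 + Y ^ 2) := by rw [hxy, hXY]; ring
  have h2 := mul_nonneg hxX hyY
  have h3 := sq_nonneg (a * A)
  nlinarith

lemma Optimal.card_shell_le {r d : ℝ} {P S A : Finset Plane} {T : Set Plane} {p : Plane}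
    (hS : Optimal r P T S) (hp : p ∈ P) (hA : A ⊆ S) (hd : 0 < d) (hdr : 3 * d ≤ r)
    (hle : ∀ s ∈ A, dist s p ≤ d)
    (hge : ∀ s ∈ A, d / 250 ≤ Metric.infDist s (P : Set Plane)) : A.card ≤ 2000 := by
  have h1 := hS.cost_le_cross hA hd.le hdr hle
  have h2 := card_mul_le_cost hge
  have h3 : Metric.infDist p (P : Set Plane) = 0 := Metric.infDist_zero_of_mem hp
  have h4 : (A.card : ℝ) * d ≤ 2000 * d := by linarith
  exact_mod_cast le_of_mul_le_mul_right h4 hd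

lemma Optimal.card_near_station_le {r : ℝ} {P S A : Finset Plane} {T : Set Plane} {p : Plane}
    (hr : 0 < r) (hS : Optimal r P T S) (hp : p ∈ P) (hA : A ⊆ S)
    (hinf : ∀ s ∈ A, Metric.infDist s (P : Set Plane) = dist s p)
    (hpos : ∀ s ∈ A, 0 < dist s p) (hle : ∀ s ∈ A, dist s p ≤ r / 3) : A.card ≤ 18000 := by
  have h1 : (A.filter fun s => r / 250 < dist s p).card ≤ 2000 := by
    refine hS.card_shell_le (d := r / 3) hp ((Finset.filter_subset _ _).trans hA) (by positivity)
      (by linarith) (fun s hs => hle s (Finset.mem_filter.1 hs).1) fun s hs => ?_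
    obtain ⟨hsA, hs⟩ := Finset.mem_filter.1 hs
    rw [hinf s hsA]
    linarith
  have h2 : (A.filter fun s => ¬ r / 250 < dist s p).card
      ≤ 2000 * (Finset.univ : Finset (Bool × Bool × Bool)).card := by
    apply Finset.card_le_mul_card_image_of_maps_to
      (f := fun s : Plane => octant (s 0 - p 0) (s 1 - p 1)) (fun _ _ => Finset.mem_univ _)
    rintro o -
    set R := (A.filter fun s => ¬ r / 250 < dist s p).filter
      fun s => octant (s 0 - p 0) (s 1 - p 1) = o with hR
    have hmem : ∀ s ∈ R, s ∈ A ∧ dist s p ≤ r / 250 ∧ octant (s 0 - p 0) (s 1 - p 1) = o := by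
      intro s hs
      simpa [hR, and_assoc] using hs
    rcases R.eq_empty_or_nonempty with h | hne
    · simp [h]
    obtain ⟨q, hq, hmax⟩ := R.exists_max_image (fun s => dist s p) hne
    obtain ⟨hqA, hqr, hqo⟩ := hmem q hq
    refine hS.card_shell_le (d := dist q p) hp (fun s hs => hA (hmem s hs).1) (hpos q hqA)
      (by linarith) hmax fun s hs => ?_
    obtain ⟨hsA, hsr, hso⟩ := hmem s hs
    by_contra hlt
    rw [hinf s hsA, not_le] at hlt
    exact hS.not_similar_direction hr hp (hA hsA) (hA hqA) (hpos s hsA) hlt.le hqr rfl rfl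
      (hinf s hsA) (dot_ge_of_octant_eq (dist_sq_eq_coord s p).symm
        (dist_sq_eq_coord q p).symm (hso.trans hqo.symm))
  have h3 : (Finset.univ : Finset (Bool × Bool × Bool)).card = 8 := by decide
  rw [h3] at h2
  have h4 := Finset.card_filter_add_card_filter_not (s := A) fun s => r / 250 < dist s p
  omega

lemma Optimal.card_near_le {r : ℝ} {P S A : Finset Plane} {T : Set Plane} (hr : 0 < r)
    (hP : P.Nonempty) (hS : Optimal r P T S) (hA : A ⊆ S)
    (hle : ∀ s ∈ A, Metric.infDist s (P : Set Plane) ≤ r / 3) : A.card ≤ 18001 * P.card := by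
  have hex : ∀ s : Plane, ∃ p ∈ P, Metric.infDist s (P : Set Plane) = dist s p := fun s =>
    P.finite_toSet.isCompact.exists_infDist_eq_dist (by simpa using hP) s
  choose f hfP hf using hex
  have h1 : (A.filter fun s => s ∈ P).card ≤ P.card :=
    Finset.card_le_card fun s hs => (Finset.mem_filter.1 hs).2
  have h2 : (A.filter fun s => s ∉ P).card ≤ 18000 * P.card := by
    apply Finset.card_le_mul_card_image_of_maps_to (f := f) (fun s _ => hfP s)
    intro p hp
    have hmem : ∀ s ∈ (A.filter fun s => s ∉ P).filter (fun s => f s = p),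
        s ∈ A ∧ s ∉ P ∧ f s = p := by
      intro s hs
      simpa [and_assoc] using hs
    refine hS.card_near_station_le hr hp (fun s hs => hA (hmem s hs).1) (fun s hs => ?_)
      (fun s hs => ?_) (fun s hs => ?_)
    · rw [hf s, (hmem s hs).2.2]
    · refine dist_pos.2 ?_
      rintro rfl
      exact (hmem s hs).2.1 hp
    · rw [← (hmem s hs).2.2, ← hf s]
      exact hle s (hmem s hs).1
  have h3 := Finset.card_filter_add_card_filter_not (s := A) fun s => s ∈ P
  omega

lemma abs_sub_le_of_floor_eq {r a b c : ℝ} (hr : 0 < r)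
    (h : ⌊5 * (a - c) / r⌋ = ⌊5 * (b - c) / r⌋) : |a - b| ≤ r / 5 := by
  have h1 := Int.abs_sub_lt_one_of_floor_eq_floor h
  rw [← sub_div, abs_div, abs_of_pos hr, div_lt_one hr,
    show 5 * (a - c) - 5 * (b - c) = 5 * (a - b) by ring, abs_mul, abs_of_pos (by norm_num)] at h1
  linarith

lemma floor_mem_Icc {r a c : ℝ} {n : ℕ} (hr : 0 < r) (h : a ∈ Set.Icc c (c + n * r / 5)) :
    ⌊5 * (a - c) / r⌋ ∈ Finset.Icc (0 : ℤ) n := by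
  obtain ⟨h1, h2⟩ := h
  rw [Finset.mem_Icc]
  constructor
  · have : 0 ≤ a - c := sub_nonneg.2 h1
    positivity
  · have h3 : 5 * (a - c) / r ≤ n := by
      rw [div_le_iff₀ hr]
      linarith
    exact_mod_cast (Int.floor_le _).trans h3

lemma Optimal.card_strip_far_le {r x₀ y₀ : ℝ} {P S A : Finset Plane} {T : Set Plane} {m : ℕ}
    (hr : 0 < r) (hS : Optimal r P T S) (hA : A ⊆ S)
    (hx : ∀ s ∈ A, s 0 ∈ Set.Icc x₀ (x₀ + r))
    (hy : ∀ s ∈ A, s 1 ∈ Set.Icc y₀ (y₀ + 2 * m * r))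
    (hfar : ∀ s ∈ A, r / 3 < Metric.infDist s (P : Set Plane)) :
    A.card ≤ 13 * (6 * (10 * m + 1)) := by
  have h : A.card ≤ 13 * (Finset.Icc (0 : ℤ) (5 : ℕ) ×ˢ Finset.Icc (0 : ℤ) (10 * m : ℕ)).card := by
    apply Finset.card_le_mul_card_image_of_maps_to
      (f := fun s : Plane => (⌊5 * (s 0 - x₀) / r⌋, ⌊5 * (s 1 - y₀) / r⌋))
    · intro s hs
      refine Finset.mem_product.2 ⟨floor_mem_Icc hr ?_, floor_mem_Icc hr ?_⟩
      · convert hx s hs using 3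
        push_cast
        ring
      · convert hy s hs using 3
        push_cast
        ring
    · rintro c -
      refine hS.card_far_le hr ((Finset.filter_subset _ _).trans hA) (fun s hs s' hs' => ?_)
        fun s hs => hfar s (Finset.mem_filter.1 hs).1
      have he := (Finset.mem_filter.1 hs).2.trans (Finset.mem_filter.1 hs').2.symm
      obtain ⟨h0, h1⟩ := Prod.mk.inj he
      have h0' := sq_le_sq' (abs_le.1 (abs_sub_le_of_floor_eq hr h0)).1
        (abs_le.1 (abs_sub_le_of_floor_eq hr h0)).2
      have h1' := sq_le_sq' (abs_le.1 (abs_sub_le_of_floor_eq hr h1)).1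
        (abs_le.1 (abs_sub_le_of_floor_eq hr h1)).2
      rw [dist_le_iff_coord (by positivity)]
      nlinarith
  have hcard (n : ℕ) : (Finset.Icc (0 : ℤ) n).card = n + 1 := by
    rw [Int.card_Icc]
    omega
  rwa [Finset.card_product, hcard, hcard] at h

theorem stmt_10 :
    ∃ C : ℕ, ∀ (r : ℝ), 0 < r →
      ∀ (P : Finset (EuclideanSpace ℝ (Fin 2))), P.Nonempty →
      ∀ (T : Set (EuclideanSpace ℝ (Fin 2))) (m : ℕ), 1 ≤ m →
      (∃ S : Finset (EuclideanSpace ℝ (Fin 2)), Optimal r P T S) →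
      ∃ S : Finset (EuclideanSpace ℝ (Fin 2)), Optimal r P T S ∧
        ∀ x₀ y₀ : ℝ,
          {s : EuclideanSpace ℝ (Fin 2) | s ∈ S ∧
              s 0 ∈ Set.Icc x₀ (x₀ + r) ∧
              s 1 ∈ Set.Icc y₀ (y₀ + 2 * m * r)}.ncard ≤ C * (m + P.card) := by
  refine ⟨18001, fun r hr P hP T m hm ⟨S, hS⟩ => ⟨S, hS, fun x₀ y₀ => ?_⟩⟩
  set A := S.filter fun s => s 0 ∈ Set.Icc x₀ (x₀ + r) ∧ s 1 ∈ Set.Icc y₀ (y₀ + 2 * m * r) with hA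
  have hset : {s : EuclideanSpace ℝ (Fin 2) | s ∈ S ∧ s 0 ∈ Set.Icc x₀ (x₀ + r) ∧
      s 1 ∈ Set.Icc y₀ (y₀ + 2 * m * r)} = A := by
    ext s
    simp [hA]
  rw [hset, Set.ncard_coe_finset]
  have hAS : A ⊆ S := Finset.filter_subset _ _
  have h1 := hS.card_near_le hr hP
    (A := A.filter fun s => Metric.infDist s (P : Set Plane) ≤ r / 3)
    ((Finset.filter_subset _ _).trans hAS) fun s hs => (Finset.mem_filter.1 hs).2
  have h2 := hS.card_strip_far_le (x₀ := x₀) (y₀ := y₀) (m := m) hr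
    (A := A.filter fun s => ¬ Metric.infDist s (P : Set Plane) ≤ r / 3)
    ((Finset.filter_subset _ _).trans hAS)
    (fun s hs => (Finset.mem_filter.1 (Finset.mem_filter.1 hs).1).2.1)
    (fun s hs => (Finset.mem_filter.1 (Finset.mem_filter.1 hs).1).2.2)
    fun s hs => not_le.1 (Finset.mem_filter.1 hs).2
  have h3 : (A.filter fun s => Metric.infDist s (P : Set Plane) ≤ r / 3).card
      + (A.filter fun s => ¬ Metric.infDist s (P : Set Plane) ≤ r / 3).card = A.card :=
    Finset.card_filter_add_card_filter_not _
  omega
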